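/- In the sequential scheduling game on m unrelated machines where players are simple-minded, define for a simple-minded equilibrium σ and 0 ≤ ℓ ≤ n the anticipated load A_i(ℓ) := D_i(ℓ) + Σ_{j > ℓ with μ(j) = i} p_j of machine i. Then for every ℓ ∈ {1,…,n}, max_i A_i(ℓ) ≤ max_i A_i(ℓ−1); that is, the maximum anticipated load never increases as the jobs make their choices. -/

import Mathlib

/-!
Sequential scheduling game on `m` unrelated machines with simple-minded players.
Machines are indexed by `Fin m`, jobs are `1, …, n`, and `p i j` is the processing
time of job `j` on machine `i`.
-/

/-- `mload p σ i ℓ`: load of machine `i` after the first `ℓ` jobs under schedule `σ`. -/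
def mload {m : ℕ} (p : Fin m → ℕ → ℝ) (σ : ℕ → Fin m) (i : Fin m) (ℓ : ℕ) : ℝ :=
  ∑ j ∈ Finset.Icc 1 ℓ, if σ j = i then p i j else 0

/-- `μ` is a selection assigning to each job `j ∈ {1, …, n}` a machine on which its
processing time is minimal (so that `p (μ j) j = p_j`). -/
def MinSel {m : ℕ} (n : ℕ) (p : Fin m → ℕ → ℝ) (μ : ℕ → Fin m) : Prop :=
  ∀ j, 1 ≤ j → j ≤ n → ∀ i, p (μ j) j ≤ p i j

/-- Anticipated cost, for a simple-minded job `j`, of choosing machine `i`: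
the current load of machine `i`, plus `p i j`, plus the minimum processing times of
all later jobs that `j` assumes (via the selection `μ`) will choose machine `i`. -/
def smCost {m : ℕ} (n : ℕ) (p : Fin m → ℕ → ℝ) (μ σ : ℕ → Fin m) (j : ℕ) (i : Fin m) : ℝ :=
  mload p σ i (j - 1) + p i j + ∑ j' ∈ Finset.Icc (j + 1) n, if μ j' = i then p (μ j') j' else 0

/-- `σ` is a simple-minded equilibrium: every job `j ∈ {1, …, n}` chooses a machine
minimizing its anticipated cost. -/
def SMEq {m : ℕ} (n : ℕ) (p : Fin m → ℕ → ℝ) (μ σ : ℕ → Fin m) : Prop :=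
  ∀ j, 1 ≤ j → j ≤ n → ∀ i, smCost n p μ σ j (σ j) ≤ smCost n p μ σ j i

/-- Makespan of an arbitrary schedule `τ` of jobs `1, …, n` on `m` machines. -/
noncomputable def makespanM {m : ℕ} (n : ℕ) (p : Fin m → ℕ → ℝ) (τ : ℕ → Fin m) : ℝ :=
  ⨆ i, mload p τ i n

/-- Optimal (minimum) makespan over all schedules of jobs `1, …, n`. -/
noncomputable def OPTm {m : ℕ} (n : ℕ) (p : Fin m → ℕ → ℝ) : ℝ :=
  sInf {x | ∃ τ : ℕ → Fin m, x = makespanM n p τ}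

/-- The anticipated load `A_i(ℓ)` of machine `i` after the first `ℓ` jobs: the actual
load plus the minimum processing times of the later jobs assumed to choose machine `i`. -/
def antLoad {m : ℕ} (n : ℕ) (p : Fin m → ℕ → ℝ) (μ σ : ℕ → Fin m) (i : Fin m) (ℓ : ℕ) : ℝ :=
  mload p σ i ℓ + ∑ j ∈ Finset.Icc (ℓ + 1) n, if μ j = i then p (μ j) j else 0

/-- On `m` unrelated machines with simple-minded players, along any
simple-minded equilibrium the maximum anticipated load never increases:
`max_i A_i(ℓ) ≤ max_i A_i(ℓ−1)` for every `ℓ ∈ {1, …, n}`. -/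
theorem antLoad_max_antitone (m n : ℕ) (hm : 0 < m)
    (p : Fin m → ℕ → ℝ) (hp : ∀ i j, 0 ≤ p i j)
    (μ σ : ℕ → Fin m) (hμ : MinSel n p μ) (hσ : SMEq n p μ σ)
    (ℓ : ℕ) (hℓ1 : 1 ≤ ℓ) (hℓ2 : ℓ ≤ n) :
    (⨆ i, antLoad n p μ σ i ℓ) ≤ ⨆ i, antLoad n p μ σ i (ℓ - 1) := by
  obtain ⟨k, rfl⟩ : ∃ k, ℓ = k + 1 := ⟨ℓ - 1, by omega⟩
  haveI : Nonempty (Fin m) := ⟨⟨0, hm⟩⟩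
  have hbdd : BddAbove (Set.range fun i => antLoad n p μ σ i k) :=
    (Set.finite_range _).bddAbove
  have hD : ∀ i, mload p σ i (k + 1) =
      mload p σ i k + if σ (k + 1) = i then p i (k + 1) else 0 := by
    intro i
    unfold mload
    rw [Finset.sum_Icc_succ_top (by omega)]
  have hS : ∀ i, (∑ j ∈ Finset.Icc (k + 1) n, if μ j = i then p (μ j) j else 0) =
      (if μ (k + 1) = i then p (μ (k + 1)) (k + 1) else 0) +
        ∑ j ∈ Finset.Icc (k + 1 + 1) n, if μ j = i then p (μ j) j else 0 := by
    intro i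
    rw [← Finset.insert_Icc_add_one_left_eq_Icc hℓ2, Finset.sum_insert (by simp)]
  simp only [Nat.add_sub_cancel]
  refine ciSup_le fun i => ?_
  by_cases hi : σ (k + 1) = i
  · refine le_trans ?_ (le_ciSup hbdd (μ (k + 1)))
    have h := hσ (k + 1) hℓ1 hℓ2 (μ (k + 1))
    simp only [smCost, Nat.add_sub_cancel, hi] at h
    simp only [antLoad, hD, hS, hi, if_true]
    linarith
  · refine le_trans ?_ (le_ciSup hbdd i)
    simp only [antLoad, hD, hS, hi, if_false]
    have := hp (μ (k + 1)) (k + 1)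
    split_ifs <;> linarith
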